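/- For every complex number d with Re(d) > 0, there holds ₃F₂(5, 1, d+1; 9/2, d; 1/2) = (7π/4)[(5/2)(1/2 − 1/d) + (4/(3π))(7/d − 2)]. -/

import Mathlib

open scoped Nat

/-- Pochhammer symbol `(x)_k = x (x+1) ⋯ (x+k-1)` for a complex number `x`. -/
noncomputable def poch (x : ℂ) (k : ℕ) : ℂ := (ascPochhammer ℂ k).eval x

/-- The generalized hypergeometric series
`ₚF_q(a₁,…,aₚ; b₁,…,b_q; z) = ∑ₖ ((a₁)ₖ ⋯ (aₚ)ₖ)/((b₁)ₖ ⋯ (b_q)ₖ) · zᵏ/k!`. -/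
noncomputable def hyp (a b : List ℂ) (z : ℂ) : ℂ :=
  ∑' k : ℕ, ((a.map (poch · k)).prod / (b.map (poch · k)).prod) * z ^ k / (k ! : ℂ)

/-- The coefficients `n! / (2n+1)!!` of Euler's series for `π / 2`. -/
noncomputable def eulerCoeff (n : ℕ) : ℝ :=
  ∏ i ∈ Finset.range n, ((i : ℝ) + 1) / (2 * i + 3)

theorem eulerCoeff_succ (n : ℕ) :
    eulerCoeff (n + 1) = eulerCoeff n * (((n : ℝ) + 1) / (2 * n + 3)) := by
  rw [eulerCoeff, Finset.prod_range_succ, eulerCoeff]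

theorem eulerCoeff_nonneg (n : ℕ) : 0 ≤ eulerCoeff n :=
  Finset.prod_nonneg fun i _ => by positivity

theorem eulerCoeff_le (n : ℕ) : eulerCoeff n ≤ (1 / 2) ^ n := by
  induction n with
  | zero => simp [eulerCoeff]
  | succ n ih =>
    rw [eulerCoeff_succ, pow_succ]
    refine mul_le_mul ih ?_ (by positivity) (by positivity)
    rw [div_le_div_iff₀ (by positivity) (by norm_num)]
    linarith

theorem eulerCoeff_eq_integral (n : ℕ) :
    eulerCoeff n = ∫ x in (0 : ℝ)..Real.pi, Real.sin x / 2 * (Real.sin x ^ 2 / 2) ^ n := by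
  have h : ∀ x : ℝ, Real.sin x / 2 * (Real.sin x ^ 2 / 2) ^ n
      = (1 / 2) ^ (n + 1) * Real.sin x ^ (2 * n + 1) := by
    intro x
    rw [div_pow, ← pow_mul, pow_succ, pow_succ, one_div, inv_pow]
    field_simp
  simp only [h]
  rw [intervalIntegral.integral_const_mul, integral_sin_pow_odd, eulerCoeff, pow_succ]
  have h2 : ((1 : ℝ) / 2) ^ n = ∏ i ∈ Finset.range n, (1 / 2 : ℝ) := by simp
  rw [h2]
  have h3 : ∀ P Q : ℝ, P * (1 / 2) * (2 * Q) = P * Q := by intros; ring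
  rw [h3, ← Finset.prod_mul_distrib]
  refine Finset.prod_congr rfl fun i _ => ?_
  field_simp

theorem integral_sin_div_one_add_cos_sq :
    ∫ x in (0 : ℝ)..Real.pi, Real.sin x / (1 + Real.cos x ^ 2) = Real.pi / 2 := by
  have hd : ∀ x ∈ Set.uIcc 0 Real.pi, HasDerivAt (fun x => -Real.arctan (Real.cos x))
      (Real.sin x / (1 + Real.cos x ^ 2)) x := by
    intro x _
    refine (Real.hasDerivAt_cos x).arctan.neg.congr_deriv ?_
    ring
  rw [intervalIntegral.integral_eq_sub_of_hasDerivAt hd]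
  · simp [Real.arctan_neg]
    linarith
  · apply Continuous.intervalIntegrable
    exact Real.continuous_sin.div (by fun_prop) fun x => by positivity

/-- Euler's series `∑ n! / (2n+1)!! = π / 2`. -/
theorem hasSum_eulerCoeff : HasSum eulerCoeff (Real.pi / 2) := by
  have hs : ∀ x : ℝ, 0 ≤ Real.sin x ^ 2 / 2 ∧ Real.sin x ^ 2 / 2 ≤ 1 / 2 := fun x =>
    ⟨by positivity, by linarith [Real.sin_sq_le_one x]⟩
  have h := intervalIntegral.hasSum_integral_of_dominated_convergence (μ := MeasureTheory.volume)
    (a := 0) (b := Real.pi)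
    (F := fun (n : ℕ) x => Real.sin x / 2 * (Real.sin x ^ 2 / 2) ^ n)
    (f := fun x => Real.sin x / (1 + Real.cos x ^ 2))
    (fun n _ => (1 / 2 : ℝ) ^ n)
    (fun n => by
      apply Continuous.aestronglyMeasurable
      fun_prop)
    (fun n => Filter.Eventually.of_forall fun x _ => by
      rw [norm_mul, norm_pow, Real.norm_of_nonneg (hs x).1]
      have h1 : ‖Real.sin x / 2‖ ≤ 1 := by
        rw [Real.norm_eq_abs, abs_div, abs_two]
        linarith [Real.abs_sin_le_one x]
      calc _ ≤ 1 * (1 / 2 : ℝ) ^ n :=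
            mul_le_mul h1 (pow_le_pow_left₀ (hs x).1 (hs x).2 n)
              (pow_nonneg (hs x).1 n) zero_le_one
        _ = _ := one_mul _)
    (Filter.Eventually.of_forall fun x _ =>
      summable_geometric_of_lt_one (by norm_num) (by norm_num))
    intervalIntegrable_const
    (Filter.Eventually.of_forall fun x _ => by
      have h1 := (hasSum_geometric_of_lt_one (hs x).1
        (lt_of_le_of_lt (hs x).2 (by norm_num))).mul_left (Real.sin x / 2)
      have h2 : 1 - Real.sin x ^ 2 / 2 = (1 + Real.cos x ^ 2) / 2 := by
        linarith [Real.sin_sq_add_cos_sq x]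
      have h3 : 1 + Real.cos x ^ 2 ≠ 0 := by positivity
      rw [h2] at h1
      rw [show Real.sin x / (1 + Real.cos x ^ 2)
        = Real.sin x / 2 * ((1 + Real.cos x ^ 2) / 2)⁻¹ by field_simp]
      exact h1)
  rw [integral_sin_div_one_add_cos_sq] at h
  simpa only [← eulerCoeff_eq_integral] using h

theorem summable_pow_mul_eulerCoeff (m : ℕ) :
    Summable fun n : ℕ => (n : ℝ) ^ m * eulerCoeff n :=
  (summable_pow_mul_geometric_of_norm_lt_one (R := ℝ) m
    (r := 1 / 2) (by norm_num)).of_nonneg_of_le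
    (fun n => mul_nonneg (by positivity) (eulerCoeff_nonneg n))
    fun n => mul_le_mul_of_nonneg_left (eulerCoeff_le n) (by positivity)

theorem Summable.hasSum_sub_succ {f : ℕ → ℝ} (hf : Summable f) :
    HasSum (fun n => f n - f (n + 1)) (f 0) := by
  have h := hf.hasSum.sub ((hasSum_nat_add_iff' 1).2 hf.hasSum)
  simpa using h

/-- The terms of `₂F₁(5, 1; 9/2; 1/2)`. -/
noncomputable def gaussTerm (k : ℕ) : ℝ := 35 / 8 * ((2 * k + 9) * eulerCoeff (k + 4))

theorem gaussTerm_succ (k : ℕ) : (2 * k + 9) * gaussTerm (k + 1) = (k + 5) * gaussTerm k := by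
  rw [gaussTerm, gaussTerm, show k + 1 + 4 = (k + 4) + 1 by ring, eulerCoeff_succ]
  push_cast
  field_simp
  ring

theorem gaussTerm_zero : gaussTerm 0 = 1 := by
  norm_num [gaussTerm, eulerCoeff, Finset.prod_range_succ]

theorem hasSum_gaussTerm : HasSum gaussTerm (35 * Real.pi / 16 - 14 / 3) := by
  have hs : Summable fun n : ℕ => (2 * (n : ℝ) + 1) * eulerCoeff n := by
    refine (((summable_pow_mul_eulerCoeff 1).mul_left 2).add
      (summable_pow_mul_eulerCoeff 0)).congr fun n => ?_
    ring
  have h := (hasSum_eulerCoeff.add (hs.hasSum_sub_succ.mul_left 2))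
  have h4 := ((hasSum_nat_add_iff' 4).2 h).mul_left (35 / 8)
  have hv : 35 / 8 * (Real.pi / 2 + 2 * ((2 * ((0 : ℕ) : ℝ) + 1) * eulerCoeff 0) -
      ∑ i ∈ Finset.range 4, (eulerCoeff i + 2 * ((2 * (i : ℝ) + 1) * eulerCoeff i -
        (2 * ((i + 1 : ℕ) : ℝ) + 1) * eulerCoeff (i + 1)))) = 35 * Real.pi / 16 - 14 / 3 := by
    norm_num [eulerCoeff, Finset.prod_range_succ, Finset.sum_range_succ]
    ring
  rw [hv] at h4
  refine h4.congr_fun fun k => ?_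
  rw [gaussTerm, eulerCoeff_succ (k + 4)]
  generalize eulerCoeff (k + 4) = e
  push_cast
  field_simp
  ring

theorem hasSum_add_two_mul_gaussTerm : HasSum (fun k : ℕ => ((k : ℝ) + 2) * gaussTerm k) 7 := by
  have hs : Summable fun k : ℕ => (2 * (k : ℝ) + 7) * gaussTerm k := by
    have h : Summable fun n : ℕ => 35 / 8 * ((4 * (n : ℝ) ^ 2 - 1) * eulerCoeff n) := by
      refine ((((summable_pow_mul_eulerCoeff 2).mul_left 4).sub
        (summable_pow_mul_eulerCoeff 0)).mul_left (35 / 8)).congr fun n => ?_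
      ring
    refine ((summable_nat_add_iff 4).2 h).congr fun k => ?_
    rw [gaussTerm]
    push_cast
    ring
  have h := hs.hasSum_sub_succ
  rw [gaussTerm_zero, Nat.cast_zero, mul_zero, zero_add, mul_one] at h
  refine h.congr_fun fun k => ?_
  have := gaussTerm_succ k
  push_cast
  linear_combination this

theorem poch_succ (x : ℂ) (k : ℕ) : poch x (k + 1) = poch x k * (x + k) :=
  ascPochhammer_succ_eval k x

theorem poch_zero (x : ℂ) : poch x 0 = 1 := by simp [poch]

theorem poch_one (k : ℕ) : poch 1 k = (k ! : ℂ) := by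
  simp [poch, ascPochhammer_eval_one]

theorem add_natCast_ne_zero_of_re_pos {x : ℂ} (hx : 0 < x.re) (k : ℕ) : x + k ≠ 0 := by
  intro h
  have h1 := congrArg Complex.re h
  simp only [Complex.add_re, Complex.natCast_re, Complex.zero_re] at h1
  have : (0 : ℝ) ≤ k := k.cast_nonneg
  linarith

theorem poch_ne_zero {x : ℂ} (hx : 0 < x.re) (k : ℕ) : poch x k ≠ 0 := by
  induction k with
  | zero => simp [poch_zero]
  | succ k ih =>
    rw [poch_succ]
    exact mul_ne_zero ih (add_natCast_ne_zero_of_re_pos hx k)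

theorem mul_poch_add_one (x : ℂ) (k : ℕ) : x * poch (x + 1) k = (x + k) * poch x k := by
  induction k with
  | zero => simp [poch_zero]
  | succ k ih =>
    rw [poch_succ, poch_succ]
    push_cast
    linear_combination (x + 1 + k) * ih

theorem poch_five_mul (k : ℕ) :
    poch 5 k * (1 / 2) ^ k = poch (9 / 2) k * (gaussTerm k : ℂ) := by
  induction k with
  | zero => simp [poch_zero, gaussTerm_zero]
  | succ k ih =>
    have h : (2 * (k : ℂ) + 9) * (gaussTerm (k + 1) : ℂ) = (k + 5) * (gaussTerm k : ℂ) := by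
      exact_mod_cast gaussTerm_succ k
    rw [poch_succ, poch_succ, pow_succ]
    linear_combination (5 + k : ℂ) / 2 * ih - poch (9 / 2) k / 2 * h

theorem gauss_second_m2_n0 (d : ℂ) (hd : 0 < d.re) :
    hyp [5, 1, d + 1] [9/2, d] (1/2) =
      7 * (Real.pi : ℂ) / 4 *
        (5/2 * (1/2 - 1 / d) + 4 / (3 * (Real.pi : ℂ)) * (7 / d - 2)) := by
  have hd0 : d ≠ 0 := by simpa using add_natCast_ne_zero_of_re_pos hd 0
  have h1 := (Complex.hasSum_ofReal.2 hasSum_gaussTerm).mul_left (1 - 2 / d)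
  have h2 := (Complex.hasSum_ofReal.2 hasSum_add_two_mul_gaussTerm).mul_left (1 / d)
  have hpi : (Real.pi : ℂ) ≠ 0 := Complex.ofReal_ne_zero.2 Real.pi_ne_zero
  rw [hyp]
  refine Eq.trans (tsum_congr fun k => ?_) ((h1.add h2).tsum_eq.trans ?_)
  · have hq : poch (9 / 2) k ≠ 0 := poch_ne_zero (by norm_num) k
    have hp : poch d k ≠ 0 := poch_ne_zero hd k
    have hf : (k ! : ℂ) ≠ 0 := Nat.cast_ne_zero.2 k.factorial_ne_zero
    have h5 : (gaussTerm k : ℂ) = poch 5 k * (1 / 2) ^ k / poch (9 / 2) k := by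
      rw [poch_five_mul, mul_div_cancel_left₀ _ hq]
    have hs : poch (d + 1) k = (d + k) * poch d k / d := by
      rw [← mul_poch_add_one, mul_div_cancel_left₀ _ hd0]
    simp only [List.map_cons, List.map_nil, List.prod_cons, List.prod_nil, poch_one]
    push_cast
    rw [h5, hs]
    field_simp
    ring
  · push_cast
    field_simp
    ring
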